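/- arXiv:1507.06066 — 2 statements merged into one kernel-verified Lean document; each statement's English description precedes it below -/
import Mathlib

section
/- Let p₁ < p₂ < ⋯ < p_n be prime numbers and let u₁, …, u_n be integers with |u_j| ≤ M for all j, not all zero such that u₁·log p₁ + ⋯ + u_n·log p_n ≠ 0. Then |u₁·log p₁ + ⋯ + u_n·log p_n| ≥ log(1 + (∏_{j=1}^n p_j)^{-M}). -/
theorem log_one_add_inv_le_log_sub_log {A B N : ℕ} (hB : 0 < B) (hBA : B < A) (hBN : B ≤ N) :
    Real.log (1 + (N : ℝ)⁻¹) ≤ Real.log A - Real.log B := by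
  have hB' : (0 : ℝ) < B := by exact_mod_cast hB
  have hBA' : (B : ℝ) + 1 ≤ A := by exact_mod_cast hBA
  have hBN' : (B : ℝ) ≤ N := by exact_mod_cast hBN
  rw [← Real.log_div (by linarith) hB'.ne']
  apply Real.log_le_log (by positivity)
  calc 1 + (N : ℝ)⁻¹ ≤ 1 + (B : ℝ)⁻¹ := by gcongr
    _ = (B + 1) / B := by field_simp
    _ ≤ A / B := by gcongr

theorem log_one_add_inv_le_abs_log_sub_log {A B N : ℕ} (hA : 0 < A) (hB : 0 < B)
    (hAB : A ≠ B) (hAN : A ≤ N) (hBN : B ≤ N) :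
    Real.log (1 + (N : ℝ)⁻¹) ≤ |Real.log A - Real.log B| := by
  rcases hAB.lt_or_gt with h | h
  · rw [abs_sub_comm]
    exact (log_one_add_inv_le_log_sub_log hA h hAN).trans (le_abs_self _)
  · exact (log_one_add_inv_le_log_sub_log hB h hBN).trans (le_abs_self _)

theorem log_prod_pow_natCast {ι : Type*} (s : Finset ι) (p e : ι → ℕ) (hp : ∀ j ∈ s, p j ≠ 0) :
    Real.log ((∏ j ∈ s, p j ^ e j : ℕ) : ℝ) = ∑ j ∈ s, (e j : ℝ) * Real.log (p j) := by
  push_cast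
  rw [Real.log_prod fun j hj => pow_ne_zero _ (Nat.cast_ne_zero.mpr (hp j hj))]
  simp only [Real.log_pow]

theorem linear_form_in_prime_logs_lower_bound (n M : ℕ) (p : Fin n → ℕ) (u : Fin n → ℤ)
    (hp : ∀ j, (p j).Prime) (hmono : StrictMono p)
    (hu : ∀ j, |u j| ≤ (M : ℤ))
    (hne : (∑ j, (u j : ℝ) * Real.log (p j)) ≠ 0) :
    |∑ j, (u j : ℝ) * Real.log (p j)| ≥
      Real.log (1 + ((∏ j, (p j : ℝ))) ^ (-(M : ℝ))) := by
  have pos (e : Fin n → ℕ) : 0 < ∏ j, p j ^ e j :=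
    Finset.prod_pos fun j _ => pow_pos (hp j).pos _
  have le {e : Fin n → ℕ} (he : ∀ j, e j ≤ M) : ∏ j, p j ^ e j ≤ (∏ j, p j) ^ M := by
    rw [← Finset.prod_pow]
    exact Finset.prod_le_prod' fun j _ => Nat.pow_le_pow_right (hp j).pos (he j)
  have sum_eq : ∑ j, (u j : ℝ) * Real.log (p j) =
      Real.log ((∏ j, p j ^ (u j).toNat : ℕ) : ℝ) -
        Real.log ((∏ j, p j ^ (-u j).toNat : ℕ) : ℝ) := by
    rw [log_prod_pow_natCast _ _ _ fun j _ => (hp j).ne_zero,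
      log_prod_pow_natCast _ _ _ fun j _ => (hp j).ne_zero, ← Finset.sum_sub_distrib]
    refine Finset.sum_congr rfl fun j _ => ?_
    rw [← sub_mul]
    congr 1
    exact_mod_cast (Int.toNat_sub_toNat_neg (u j)).symm
  rw [sum_eq] at hne ⊢
  have main := log_one_add_inv_le_abs_log_sub_log (pos _) (pos _)
    (fun h => hne (by rw [h, sub_self]))
    (le fun j => by have := abs_le.mp (hu j); omega)
    (le fun j => by have := abs_le.mp (hu j); omega)
  rw [Real.rpow_neg (Finset.prod_nonneg fun j _ => Nat.cast_nonneg _), Real.rpow_natCast]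
  simpa only [Nat.cast_pow, Nat.cast_prod] using main
end

section
/- Let λ₁, …, λ_n and β₁, …, β_n be real numbers and M a positive integer, such that for all integers u₁, …, u_n with |u_j| ≤ M, u₁λ₁ + ⋯ + u_nλ_n = 0 implies u₁β₁ + ⋯ + u_nβ_n ∈ ℤ. Let δ₁, …, δ_n > 0, Δ = ∑ δ_j, T₁ < T₂, and let Λ be the minimum of |u₁λ₁ + ⋯ + u_nλ_n| over all integer tuples with |u_j| ≤ M and u₁λ₁ + ⋯ + u_nλ_n ≠ 0 (assume such tuples exist). Then inf_{t ∈ [T₁,T₂)} ∑_{j=1}^n δ_j·‖λ_j t - β_j‖² ≤ (Δ/4)·sin²(π/(2(M+1))) + Δ·M^n/(4π·Λ·(T₂-T₁)). -/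
/-- Distance from a real number to the nearest integer. -/
noncomputable def nearestIntDist (x : ℝ) : ℝ := ⨅ n : ℤ, |x - n|

open Finset in
/-- Collecting the terms of a finite sum of monomials by their exponents. -/
theorem sum_mul_zpow_eq_sum_fiberwise {ι : Type*} (s : Finset ι) (w : ι → ℝ) (m : ι → ℤ)
    (t : Finset ℤ) (hm : ∀ i ∈ s, m i ∈ t) (z : ℂ) :
    ∑ i ∈ s, (w i : ℂ) * z ^ m i =
      ∑ u ∈ t, ((∑ i ∈ s with m i = u, w i : ℝ) : ℂ) * z ^ u := by
  rw [← sum_fiberwise_of_maps_to hm]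
  refine sum_congr rfl fun u _ => ?_
  rw [Complex.ofReal_sum, sum_mul]
  refine sum_congr rfl fun i hi => ?_
  rw [(mem_filter.1 hi).2]

theorem sum_sin_mul_pow (θ : ℝ) (z : ℂ) (m : ℕ) :
    (z ^ 2 + 1 - 2 * (Real.cos θ : ℂ) * z) *
        ∑ k ∈ Finset.range m, (Real.sin (θ * (k + 1)) : ℂ) * z ^ k =
      (Real.sin (θ * m) : ℂ) * z ^ (m + 1) + (Real.sin θ : ℂ) -
        (Real.sin (θ * (m + 1)) : ℂ) * z ^ m := by
  induction m with
  | zero => simp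
  | succ m ih =>
    rw [Finset.sum_range_succ, mul_add, ih]
    have h : Real.sin (θ * (m + 1 + 1)) =
        2 * Real.cos θ * Real.sin (θ * (m + 1)) - Real.sin (θ * m) := by
      rw [show θ * (m + 1 + 1) = θ * (m + 1) + θ by ring,
        show θ * (m : ℝ) = θ * (m + 1) - θ by ring, Real.sin_add, Real.sin_sub]
      ring
    push_cast at h ⊢
    rw_mod_cast [h]
    push_cast
    ring

/-- The character `x ↦ exp (2πix)` of the reals. -/
noncomputable def expTwoPi (x : ℝ) : ℂ := Complex.exp ((2 * Real.pi * x : ℝ) * Complex.I)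

theorem expTwoPi_ne_zero (x : ℝ) : expTwoPi x ≠ 0 := Complex.exp_ne_zero _

theorem expTwoPi_zpow (x : ℝ) (u : ℤ) : expTwoPi x ^ u = expTwoPi (u * x) := by
  rw [expTwoPi, expTwoPi, ← Complex.exp_int_mul]
  congr 1
  push_cast
  ring

theorem expTwoPi_sum {ι : Type*} (s : Finset ι) (f : ι → ℝ) :
    expTwoPi (∑ i ∈ s, f i) = ∏ i ∈ s, expTwoPi (f i) := by
  simp only [expTwoPi, ← Complex.exp_sum, Finset.mul_sum, Complex.ofReal_sum, Finset.sum_mul]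

theorem expTwoPi_re (x : ℝ) : (expTwoPi x).re = Real.cos (2 * Real.pi * x) := by
  rw [expTwoPi, Complex.exp_ofReal_mul_I_re]

theorem expTwoPi_zero : expTwoPi 0 = 1 := by simp [expTwoPi]

theorem inv_expTwoPi (x : ℝ) : (expTwoPi x)⁻¹ = expTwoPi (-x) := by
  rw [expTwoPi, expTwoPi, ← Complex.exp_neg]
  congr 1
  push_cast
  ring

theorem conj_expTwoPi (x : ℝ) : (starRingEnd ℂ) (expTwoPi x) = (expTwoPi x)⁻¹ := by
  rw [inv_expTwoPi, expTwoPi, expTwoPi, ← Complex.exp_conj]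
  simp only [map_mul, Complex.conj_ofReal, Complex.conj_I]
  congr 1
  push_cast
  ring

theorem two_mul_cos_eq_expTwoPi (x : ℝ) :
    2 * (Real.cos (2 * Real.pi * x) : ℂ) = expTwoPi x + (expTwoPi x)⁻¹ := by
  rw [inv_expTwoPi, expTwoPi, expTwoPi, Complex.ofReal_cos, Complex.two_cos]
  congr 2
  push_cast
  ring

open Finset in
/-- Fejér's extremal trigonometric polynomial `K` of degree less than `M`: both `K` and its product
with `cos (2πx) - cos (π / (M + 1))` have nonnegative Fourier coefficients. -/
theorem exists_fejer_extremal_kernel (M : ℕ) (hM : 0 < M) :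
    ∃ (K : ℝ → ℝ) (c d : ℤ → ℝ), (∀ x, 0 ≤ K x) ∧ K 0 ≤ M ∧ (∀ u, 0 ≤ c u) ∧ (∀ u, 0 ≤ d u) ∧
      c 0 = 1 ∧
      (∀ x, ∑ u ∈ Icc (-(M : ℤ)) M, (c u : ℂ) * expTwoPi (u * x) = K x) ∧
      (∀ x, ∑ u ∈ Icc (-(M : ℤ)) M, (d u : ℂ) * expTwoPi (u * x) =
        (K x : ℂ) * ((Real.cos (2 * Real.pi * x) - Real.cos (Real.pi / (M + 1)) : ℝ) : ℂ)) := by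
  set θ : ℝ := Real.pi / (M + 1) with hθ
  have hθM : θ * (M + 1) = Real.pi := by rw [hθ]; field_simp
  have hθ0 : 0 < θ := by positivity
  have hpos : ∀ k ∈ range M, 0 < Real.sin (θ * (k + 1)) := fun k hk => by
    refine Real.sin_pos_of_pos_of_lt_pi (by positivity) ?_
    rw [← hθM]
    have : (k : ℝ) < M := by exact_mod_cast mem_range.1 hk
    gcongr
  set S : ℝ := ∑ k ∈ range M, Real.sin (θ * (k + 1)) ^ 2 with hS
  have hSpos : 0 < S :=
    sum_pos (fun k hk => pow_pos (hpos k hk) 2) ⟨0, mem_range.2 hM⟩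
  have hsinθ : 0 < Real.sin θ := by simpa using hpos 0 (mem_range.2 hM)
  set a : ℕ → ℝ := fun k => Real.sin (θ * (k + 1)) with ha
  set P : ℝ → ℂ := fun x => ∑ k ∈ range M, (a k : ℂ) * expTwoPi x ^ k with hP
  have hconj : ∀ x, (starRingEnd ℂ) (P x) = ∑ k ∈ range M, (a k : ℂ) * (expTwoPi x)⁻¹ ^ k := by
    intro x
    simp [hP, map_sum, conj_expTwoPi]
  have hnorm : ∀ x, ((Complex.normSq (P x) : ℝ) : ℂ) =
      P x * ∑ k ∈ range M, (a k : ℂ) * (expTwoPi x)⁻¹ ^ k := by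
    intro x
    rw [← hconj, Complex.mul_conj]
  have hK : ∀ x, ((Complex.normSq (P x) : ℝ) : ℂ) = ∑ p ∈ range M ×ˢ range M,
      ((a p.1 * a p.2 : ℝ) : ℂ) * expTwoPi x ^ ((p.1 : ℤ) - p.2) := by
    intro x
    rw [hnorm, hP, sum_mul_sum, sum_product]
    refine sum_congr rfl fun k _ => sum_congr rfl fun l _ => ?_
    rw [zpow_sub₀ (expTwoPi_ne_zero x)]
    push_cast
    simp only [zpow_natCast, inv_pow]
    ring
  have hR : ∀ x, ((Complex.normSq (P x) : ℝ) : ℂ) *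
      ((Real.cos (2 * Real.pi * x) - Real.cos θ : ℝ) : ℂ) =
      ∑ p ∈ range M ×ˢ (univ : Finset Bool), ((Real.sin θ / 2 * a p.1 : ℝ) : ℂ) *
        expTwoPi x ^ (if p.2 then (M : ℤ) - p.1 else -1 - p.1) := by
    intro x
    have hz := expTwoPi_ne_zero x
    have h1 := sum_sin_mul_pow θ (expTwoPi x) M
    have h2 : Real.sin (θ * M) = Real.sin θ := by
      rw [show θ * (M : ℝ) = Real.pi - θ by linear_combination hθM, Real.sin_pi_sub]
    rw [hθM, Real.sin_pi, h2] at h1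
    have h3 := two_mul_cos_eq_expTwoPi x
    have h4 : P x * ((Real.cos (2 * Real.pi * x) - Real.cos θ : ℝ) : ℂ) =
        (Real.sin θ / 2 : ℝ) * (expTwoPi x ^ (M : ℤ) + expTwoPi x ^ (-1 : ℤ)) := by
      have h5 : expTwoPi x * (2 * (Real.cos (2 * Real.pi * x) : ℂ)) = expTwoPi x ^ 2 + 1 := by
        rw [h3, mul_add, mul_inv_cancel₀ hz]; ring
      apply mul_left_cancel₀ hz
      rw [zpow_natCast, zpow_neg_one, mul_left_comm _ _ (_ + _), mul_add (expTwoPi x),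
        mul_inv_cancel₀ hz]
      push_cast at h1 h5 ⊢
      simp only [hP, ha]
      push_cast
      linear_combination (1 / 2 : ℂ) * h1 +
        (1 / 2 : ℂ) * (∑ k ∈ range M, Complex.sin (θ * (k + 1)) * expTwoPi x ^ k) * h5
    rw [hnorm, mul_right_comm, h4, sum_product, mul_sum]
    refine sum_congr rfl fun k _ => ?_
    rw [Fintype.sum_bool]
    simp only [if_true, Bool.false_eq_true, if_false]
    rw [zpow_sub₀ hz, zpow_sub₀ hz]
    push_cast
    simp only [zpow_natCast, inv_pow]
    field_simp
  refine ⟨fun x => Complex.normSq (P x) / S,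
    fun u => (∑ p ∈ range M ×ˢ range M with (p.1 : ℤ) - p.2 = u, a p.1 * a p.2) / S,
    fun u => (∑ p ∈ range M ×ˢ (univ : Finset Bool) with
      (if p.2 then (M : ℤ) - p.1 else -1 - p.1) = u, Real.sin θ / 2 * a p.1) / S,
    fun x => div_nonneg (Complex.normSq_nonneg _) hSpos.le, ?_, fun u => ?_, fun u => ?_, ?_,
    fun x => ?_, fun x => ?_⟩
  · rw [div_le_iff₀ hSpos]
    have h0 : P 0 = ((∑ k ∈ range M, a k : ℝ) : ℂ) := by
      simp [hP, expTwoPi_zero]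
    rw [h0, Complex.normSq_ofReal, ← sq]
    simpa using sq_sum_le_card_mul_sum_sq (s := range M) (f := a)
  · refine div_nonneg (sum_nonneg fun p hp => ?_) hSpos.le
    have hp := mem_product.1 (mem_filter.1 hp).1
    exact (mul_pos (hpos _ hp.1) (hpos _ hp.2)).le
  · refine div_nonneg (sum_nonneg fun p hp => ?_) hSpos.le
    have hp := mem_product.1 (mem_filter.1 hp).1
    exact (mul_pos (half_pos hsinθ) (hpos _ hp.1)).le
  · rw [div_eq_one_iff_eq hSpos.ne', hS, sum_filter, sum_product]
    refine sum_congr rfl fun k hk => ?_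
    rw [sum_eq_single_of_mem k hk]
    · simp [ha, sq]
    · intro l _ hl
      rw [if_neg]
      omega
  · have h := (hK x).trans (sum_mul_zpow_eq_sum_fiberwise _ (fun p : ℕ × ℕ => a p.1 * a p.2)
      (fun p => (p.1 : ℤ) - p.2) (Icc (-(M : ℤ)) M) (fun p hp => by
        simp only [mem_product, mem_range, mem_Icc] at hp ⊢; omega) _)
    rw [Complex.ofReal_div, h, sum_div]
    refine sum_congr rfl fun u _ => ?_
    rw [expTwoPi_zpow, Complex.ofReal_div]
    ring
  · have h := (hR x).trans (sum_mul_zpow_eq_sum_fiberwise _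
      (fun p : ℕ × Bool => Real.sin θ / 2 * a p.1)
      (fun p => if p.2 then (M : ℤ) - p.1 else -1 - p.1) (Icc (-(M : ℤ)) M) (fun p hp => by
        simp only [mem_product, mem_range, mem_Icc] at hp ⊢; split_ifs <;> omega) _)
    rw [Complex.ofReal_div, div_mul_eq_mul_div, h, sum_div]
    refine sum_congr rfl fun u _ => ?_
    rw [expTwoPi_zpow, Complex.ofReal_div]
    ring

open Finset in
theorem prod_sum_mul_expTwoPi {ι : Type*} [Fintype ι] [DecidableEq ι] (s : Finset ℤ)
    (f : ι → ℤ → ℝ) (x : ι → ℝ) :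
    ∏ i, ∑ u ∈ s, (f i u : ℂ) * expTwoPi (u * x i) =
      ∑ u ∈ Fintype.piFinset fun _ : ι => s,
        ((∏ i, f i (u i) : ℝ) : ℂ) * expTwoPi (∑ i, u i * x i) := by
  rw [prod_univ_sum]
  refine sum_congr rfl fun u _ => ?_
  rw [prod_mul_distrib, expTwoPi_sum, Complex.ofReal_prod]

open Finset in
/-- A nonnegative multiple of `∑ j, δ j * (cos (2πx j) - cos (π / (M + 1)) + 2η)` with nonnegative
Fourier coefficients. -/
theorem exists_nonneg_coeff_kernel {ι : Type*} [Fintype ι] [DecidableEq ι] (M : ℕ) (hM : 0 < M)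
    (delta : ι → ℝ) (hdelta : ∀ j, 0 ≤ delta j) (η : ℝ) (hη : 0 ≤ η) :
    ∃ (F : (ι → ℝ) → ℝ) (W : (ι → ℤ) → ℝ), (∀ x, 0 ≤ F x) ∧ F 0 ≤ (M : ℝ) ^ Fintype.card ι ∧
      (∀ u, 0 ≤ W u) ∧ 2 * η * ∑ j, delta j ≤ W 0 ∧
      ∀ x, F x * ∑ j, delta j *
          (Real.cos (2 * Real.pi * x j) - Real.cos (Real.pi / (M + 1)) + 2 * η) =
        ∑ u ∈ Fintype.piFinset fun _ : ι => Icc (-(M : ℤ)) M,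
          W u * Real.cos (2 * Real.pi * ∑ i, u i * x i) := by
  obtain ⟨K, c, d, hK, hK0, hc, hd, hc0, hcK, hdK⟩ := exists_fejer_extremal_kernel M hM
  set f : ι → ι → ℤ → ℝ := fun j => Function.update (fun _ => c) j (fun u => d u + 2 * η * c u)
    with hf
  have hf0 : ∀ j i u, 0 ≤ f j i u := by
    intro j i u
    rcases eq_or_ne i j with rfl | h
    · simp only [hf, Function.update_self]
      have := hc u
      have := hd u
      positivity
    · simp only [hf, Function.update_of_ne h, hc]
  refine ⟨fun x => ∏ i, K (x i), fun u => ∑ j, delta j * ∏ i, f j i (u i),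
    fun x => prod_nonneg fun i _ => hK _, ?_,
    fun u => sum_nonneg fun j _ => mul_nonneg (hdelta j) (prod_nonneg fun i _ => hf0 j i _), ?_,
    fun x => ?_⟩
  · simpa using pow_le_pow_left₀ (hK 0) hK0 (Fintype.card ι)
  · rw [mul_sum]
    refine sum_le_sum fun j _ => ?_
    rw [mul_comm]
    refine mul_le_mul_of_nonneg_left ?_ (hdelta j)
    rw [← mul_prod_erase univ _ (mem_univ j), prod_eq_one]
    · simp [hf, hc0, hd 0]
    · intro i hi
      simp [hf, Function.update_of_ne (ne_of_mem_erase hi), hc0]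
  · have key : ∀ j, (∏ i, K (x i)) *
        (Real.cos (2 * Real.pi * x j) - Real.cos (Real.pi / (M + 1)) + 2 * η) =
        ∑ u ∈ Fintype.piFinset fun _ : ι => Icc (-(M : ℤ)) M,
          (∏ i, f j i (u i)) * Real.cos (2 * Real.pi * ∑ i, u i * x i) := by
      intro j
      have h := prod_sum_mul_expTwoPi (Icc (-(M : ℤ)) M) (f j) x
      have hj : ∑ u ∈ Icc (-(M : ℤ)) M, (f j j u : ℂ) * expTwoPi (u * x j) = (K (x j) : ℂ) *
          ((Real.cos (2 * Real.pi * x j) - Real.cos (Real.pi / (M + 1)) + 2 * η : ℝ) : ℂ) := by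
        rw [Complex.ofReal_add, mul_add, ← hdK, ← hcK, sum_mul, ← sum_add_distrib]
        refine sum_congr rfl fun u _ => ?_
        simp only [hf, Function.update_self]
        push_cast
        ring
      have hi : ∀ i ∈ univ.erase j,
          ∑ u ∈ Icc (-(M : ℤ)) M, (f j i u : ℂ) * expTwoPi (u * x i) = (K (x i) : ℂ) := by
        intro i hi
        simp only [hf, Function.update_of_ne (ne_of_mem_erase hi), hcK]
      rw [← mul_prod_erase univ _ (mem_univ j), hj, prod_congr rfl hi, mul_right_comm,
        mul_prod_erase univ (fun i => (K (x i) : ℂ)) (mem_univ j), ← Complex.ofReal_prod,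
        ← Complex.ofReal_mul] at h
      have h' := congrArg Complex.re h
      simpa only [Complex.ofReal_re, Complex.re_sum, Complex.re_ofReal_mul, expTwoPi_re] using h'
    calc _ = ∑ j, delta j * ((∏ i, K (x i)) *
          (Real.cos (2 * Real.pi * x j) - Real.cos (Real.pi / (M + 1)) + 2 * η)) := by
          rw [mul_sum]
          exact sum_congr rfl fun j _ => by ring
      _ = _ := by
          simp only [key, mul_sum, sum_mul]
          rw [sum_comm]
          exact sum_congr rfl fun u _ => sum_congr rfl fun j _ => by ring

theorem neg_inv_le_integral_cos (ω b Λ T₁ T₂ : ℝ) (hΛ : 0 < Λ) (hω : Λ ≤ |ω|) :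
    -(1 / (Real.pi * Λ)) ≤ ∫ t in T₁..T₂, Real.cos (2 * Real.pi * (ω * t - b)) := by
  have hω0 : ω ≠ 0 := abs_pos.1 (hΛ.trans_le hω)
  have hpi := Real.pi_pos
  have h : ∀ t, Real.cos (2 * Real.pi * (ω * t - b)) =
      Real.cos (2 * Real.pi * ω * t - 2 * Real.pi * b) := fun t => by congr 1; ring
  simp only [h]
  rw [intervalIntegral.integral_comp_mul_sub _ (by positivity), integral_cos]
  refine neg_le_of_abs_le ?_
  rw [smul_eq_mul, abs_mul, abs_inv, abs_mul, abs_of_pos (by positivity : 0 < 2 * Real.pi)]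
  set A := Real.sin (2 * Real.pi * ω * T₂ - 2 * Real.pi * b)
  set B := Real.sin (2 * Real.pi * ω * T₁ - 2 * Real.pi * b)
  have hAB : |A - B| ≤ 2 := by
    rw [abs_le]
    constructor <;> linarith [Real.neg_one_le_sin (2 * Real.pi * ω * T₂ - 2 * Real.pi * b),
      Real.sin_le_one (2 * Real.pi * ω * T₂ - 2 * Real.pi * b),
      Real.neg_one_le_sin (2 * Real.pi * ω * T₁ - 2 * Real.pi * b),
      Real.sin_le_one (2 * Real.pi * ω * T₁ - 2 * Real.pi * b)]
  calc (2 * Real.pi * |ω|)⁻¹ * |A - B| ≤ (2 * Real.pi * Λ)⁻¹ * 2 := by gcongr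
    _ = 1 / (Real.pi * Λ) := by field_simp

theorem nearestIntDist_sq_le (x : ℝ) :
    nearestIntDist x ^ 2 ≤ Real.sin (Real.pi * x) ^ 2 / 4 := by
  have hpi := Real.pi_pos
  have h0 : 0 ≤ nearestIntDist x := Real.iInf_nonneg fun _ => abs_nonneg _
  have h1 : nearestIntDist x ≤ |x - round x| :=
    ciInf_le ⟨0, by rintro _ ⟨n, rfl⟩; exact abs_nonneg _⟩ (round x)
  have h2 : |x - round x| ≤ 1 / 2 := abs_sub_round x
  have h3 := Real.mul_le_sin (x := Real.pi * |x - round x|) (by positivity) (by nlinarith)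
  rw [show 2 / Real.pi * (Real.pi * |x - round x|) = 2 * |x - round x| by field_simp] at h3
  have h4 : Real.sin (Real.pi * |x - round x|) ^ 2 = Real.sin (Real.pi * x) ^ 2 := by
    rw [Real.sin_sq_eq_half_sub, Real.sin_sq_eq_half_sub, ← Real.cos_sub_int_mul_two_pi
      (2 * (Real.pi * x)) (round x), ← Real.cos_abs (2 * (Real.pi * x) - _)]
    congr 3
    rw [show 2 * (Real.pi * x) - round x * (2 * Real.pi) = 2 * Real.pi * (x - round x) by ring,
      abs_mul, abs_of_pos (by positivity : 0 < 2 * Real.pi)]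
    ring
  have h5 := pow_le_pow_left₀ (by positivity) (show 2 * nearestIntDist x ≤ _ by linarith) 2
    (b := Real.sin (Real.pi * |x - round x|))
  rw [h4] at h5
  linarith

/-- Chen's theorem on inhomogeneous Diophantine approximation (one-dimensional case). -/
theorem chen_inhomogeneous_approx (n M : ℕ) (hM : 0 < M)
    (lam beta : Fin n → ℝ) (delta : Fin n → ℝ) (hdelta : ∀ j, 0 < delta j)
    (T₁ T₂ : ℝ) (hT : T₁ < T₂) (Δ : ℝ) (hΔ : Δ = ∑ j, delta j)
    (hres : ∀ u : Fin n → ℤ, (∀ j, |u j| ≤ (M : ℤ)) →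
      (∑ j, (u j : ℝ) * lam j) = 0 → ∃ k : ℤ, (∑ j, (u j : ℝ) * beta j) = (k : ℝ))
    (Λ : ℝ)
    (hΛ : IsLeast {v : ℝ | ∃ u : Fin n → ℤ, (∀ j, |u j| ≤ (M : ℤ)) ∧
      (∑ j, (u j : ℝ) * lam j) ≠ 0 ∧ v = |∑ j, (u j : ℝ) * lam j|} Λ) :
    sInf ((fun t => ∑ j, delta j * (nearestIntDist (lam j * t - beta j)) ^ 2) '' Set.Ico T₁ T₂) ≤
      (Δ / 4) * Real.sin (Real.pi / (2 * (M + 1))) ^ 2 +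
        Δ * (M : ℝ) ^ n / (4 * Real.pi * Λ * (T₂ - T₁)) := by
  have hpi := Real.pi_pos
  have hTpos : 0 < T₂ - T₁ := sub_pos.2 hT
  obtain ⟨⟨v, hv, hv0, hvΛ⟩, hmin⟩ := hΛ
  have hΛ0 : 0 < Λ := hvΛ ▸ abs_pos.2 hv0
  have hΔ0 : 0 < Δ := by
    obtain ⟨j, -, -⟩ := Finset.exists_ne_zero_of_sum_ne_zero hv0
    exact hΔ ▸ Finset.sum_pos (fun j _ => hdelta j) ⟨j, Finset.mem_univ j⟩
  set I := sInf ((fun t => ∑ j, delta j * (nearestIntDist (lam j * t - beta j)) ^ 2) ''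
    Set.Ico T₁ T₂)
  have hIle : ∀ t ∈ Set.Ico T₁ T₂,
      4 * I ≤ ∑ j, delta j * Real.sin (Real.pi * (lam j * t - beta j)) ^ 2 := by
    intro t ht
    have h1 : I ≤ ∑ j, delta j * (nearestIntDist (lam j * t - beta j)) ^ 2 := by
      refine csInf_le ⟨0, ?_⟩ ⟨t, ht, rfl⟩
      rintro _ ⟨s, -, rfl⟩
      exact Finset.sum_nonneg fun j _ => mul_nonneg (hdelta j).le (sq_nonneg _)
    have h2 : ∑ j, delta j * (nearestIntDist (lam j * t - beta j)) ^ 2 ≤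
        ∑ j, delta j * (Real.sin (Real.pi * (lam j * t - beta j)) ^ 2 / 4) :=
      Finset.sum_le_sum fun j _ =>
        mul_le_mul_of_nonneg_left (nearestIntDist_sq_le _) (hdelta j).le
    simp only [← mul_div_assoc, ← Finset.sum_div] at h2
    linarith
  have hIΔ : 4 * I ≤ Δ := by
    refine (hIle T₁ ⟨le_rfl, hT⟩).trans ?_
    rw [hΔ]
    exact Finset.sum_le_sum fun j _ => mul_le_of_le_one_right (hdelta j).le (Real.sin_sq_le_one _)
  set s := Real.sin (Real.pi / (2 * (M + 1))) ^ 2 with hs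
  have hcos : Real.cos (Real.pi / (M + 1)) = 1 - 2 * s := by
    rw [hs, Real.sin_sq_eq_half_sub,
      show 2 * (Real.pi / (2 * ((M : ℝ) + 1))) = Real.pi / (M + 1) by field_simp]
    ring
  set η := 4 * I / Δ - s with hη
  have hηΔ : 4 * I = Δ * (s + η) := by rw [hη]; field_simp; ring
  have hsη : s + η ≤ 1 := by nlinarith
  suffices h : η ≤ (M : ℝ) ^ n / (Real.pi * Λ * (T₂ - T₁)) by
    have h' := mul_le_mul_of_nonneg_left h (div_pos hΔ0 four_pos).le
    have h'' : Δ / 4 * ((M : ℝ) ^ n / (Real.pi * Λ * (T₂ - T₁))) =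
        Δ * (M : ℝ) ^ n / (4 * Real.pi * Λ * (T₂ - T₁)) := by field_simp
    linarith
  rcases le_total η 0 with hη0 | hη0
  · exact hη0.trans (by positivity)
  obtain ⟨F, W, hF, hF0, hW, hW0, hFW⟩ :=
    exists_nonneg_coeff_kernel M hM delta (fun j => (hdelta j).le) η hη0
  rw [← hΔ] at hW0
  rw [Fintype.card_fin] at hF0
  set U := Fintype.piFinset fun _ : Fin n => Finset.Icc (-(M : ℤ)) M
  have hmemU : ∀ u ∈ U, ∀ j, |u j| ≤ (M : ℤ) := fun u hu j =>
    abs_le.2 (Finset.mem_Icc.1 (Fintype.mem_piFinset.1 hu j))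
  have h0U : (0 : Fin n → ℤ) ∈ U := Fintype.mem_piFinset.2 fun j => by simp
  set J : (Fin n → ℤ) → ℝ → ℝ := fun u t =>
    Real.cos (2 * Real.pi * ((∑ i, (u i : ℝ) * lam i) * t - ∑ i, (u i : ℝ) * beta i)) with hJ
  have hJc : ∀ u, Continuous (J u) := fun u => by simp only [hJ]; fun_prop
  have hupper : ∑ u ∈ U, W u * ∫ t in T₁..T₂, J u t ≤ 0 := by
    simp only [← intervalIntegral.integral_const_mul]
    rw [← intervalIntegral.integral_finsetSum fun u _ =>
      ((hJc u).const_mul (W u)).intervalIntegrable _ _, ← neg_nonneg,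
      ← intervalIntegral.integral_neg]
    have hle : ∀ t ∈ Set.Ico T₁ T₂, 0 ≤ -∑ u ∈ U, W u * J u t := by
      intro t ht
      have h := hFW fun j => lam j * t - beta j
      have hJt : ∀ u : Fin n → ℤ, ∑ i, (u i : ℝ) * (lam i * t - beta i) =
          (∑ i, (u i : ℝ) * lam i) * t - ∑ i, (u i : ℝ) * beta i := fun u => by
        rw [Finset.sum_mul, ← Finset.sum_sub_distrib]
        exact Finset.sum_congr rfl fun i _ => by ring
      simp only [hJt] at h
      rw [← h, neg_nonneg]
      refine mul_nonpos_of_nonneg_of_nonpos (hF _) ?_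
      have h2 : ∑ j, delta j * (Real.cos (2 * Real.pi * (lam j * t - beta j)) -
          Real.cos (Real.pi / (M + 1)) + 2 * η) =
          2 * (Δ * (s + η)) -
            2 * ∑ j, delta j * Real.sin (Real.pi * (lam j * t - beta j)) ^ 2 := by
        rw [hΔ, Finset.sum_mul, Finset.mul_sum, Finset.mul_sum, ← Finset.sum_sub_distrib]
        refine Finset.sum_congr rfl fun j _ => ?_
        rw [hcos, Real.sin_sq_eq_half_sub, mul_assoc 2 Real.pi]
        ring
      have := hIle t ht
      rw [h2]
      linarith
    rw [intervalIntegral.integral_of_le hT.le, MeasureTheory.integral_Ioc_eq_integral_Ioo]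
    exact MeasureTheory.setIntegral_nonneg measurableSet_Ioo fun t ht =>
      hle t (Set.Ioo_subset_Ico_self ht)
  have hJ1 : ∀ u ∈ U, ∑ i, (u i : ℝ) * lam i = 0 → ∫ t in T₁..T₂, J u t = T₂ - T₁ := by
    intro u hu h
    obtain ⟨k, hk⟩ := hres u (hmemU u hu) h
    have : ∀ t, J u t = 1 := fun t => by
      simp only [hJ, h, hk, zero_mul, zero_sub]
      rw [mul_neg, Real.cos_neg, mul_comm, Real.cos_int_mul_two_pi]
    simp [this]
  have hJ2 : ∀ u ∈ U, -(1 / (Real.pi * Λ)) ≤ ∫ t in T₁..T₂, J u t := by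
    intro u hu
    by_cases h : ∑ i, (u i : ℝ) * lam i = 0
    · rw [hJ1 u hu h]
      have : 0 < 1 / (Real.pi * Λ) := by positivity
      linarith
    · exact neg_inv_le_integral_cos _ _ Λ T₁ T₂ hΛ0 (hmin ⟨u, hmemU u hu, h, rfl⟩)
  have hsum : ∑ u ∈ U, W u = F 0 * (2 * (Δ * (s + η))) := by
    have h := hFW 0
    simp only [Pi.zero_apply, mul_zero, Finset.sum_const_zero, Real.cos_zero, mul_one] at h
    rw [← h, ← Finset.sum_mul, ← hΔ, hcos]
    ring
  have hlower : W 0 * (T₂ - T₁) - (∑ u ∈ U, W u) * (1 / (Real.pi * Λ)) ≤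
      ∑ u ∈ U, W u * ∫ t in T₁..T₂, J u t := by
    rw [← Finset.add_sum_erase U W h0U,
      ← Finset.add_sum_erase U (fun u => W u * ∫ t in T₁..T₂, J u t) h0U,
      hJ1 0 h0U (by simp)]
    have h1 : (∑ u ∈ U.erase 0, W u) * -(1 / (Real.pi * Λ)) ≤
        ∑ u ∈ U.erase 0, W u * ∫ t in T₁..T₂, J u t := by
      rw [Finset.sum_mul]
      exact Finset.sum_le_sum fun u hu =>
        mul_le_mul_of_nonneg_left (hJ2 u (Finset.mem_of_mem_erase hu)) (hW u)
    have h2 : 0 ≤ W 0 * (1 / (Real.pi * Λ)) := mul_nonneg (hW 0) (by positivity)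
    linarith
  have hsumle : ∑ u ∈ U, W u ≤ (M : ℝ) ^ n * (2 * Δ) := by
    rw [hsum]
    have : Δ * (s + η) ≤ Δ := mul_le_of_le_one_right hΔ0.le hsη
    have : 0 ≤ s := sq_nonneg _
    gcongr
  have hfin : 2 * η * Δ * (T₂ - T₁) ≤ (M : ℝ) ^ n * (2 * Δ) * (1 / (Real.pi * Λ)) := by
    have h1 := mul_le_mul_of_nonneg_right hW0 hTpos.le
    have h2 := mul_le_mul_of_nonneg_right hsumle (by positivity : 0 ≤ 1 / (Real.pi * Λ))
    linarith
  rw [le_div_iff₀ (by positivity)]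
  rw [mul_one_div, le_div_iff₀ (by positivity)] at hfin
  refine le_of_mul_le_mul_left ?_ (by positivity : 0 < 2 * Δ)
  linarith
end
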